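/- (Orbi-analogue of the Pólya–Redfield theorem) Let (X, f) be an A-weighted set and let G ⊆ S_m be a group of permutations of [m], acting on the set X^[m] of maps α : [m] → X (a permutation g sends α to α ∘ g⁻¹), with weight f̃(α) = Π_{i=1}^m f(α(i)). Then |G| · |X^[m]/^orb G|_{f̃} = Σ_{ḡ ∈ C(G)} |ḡ| · Σ_{h ∈ Z(g)} Π_{k=1}^{m} (|X|_{f^k})^{b_k(C(g) ∨ C(h))}, where |X|_{f^k} = Σ_{x ∈ X} f(x)^k. -/

import Mathlib

/-- The action of the centralizer `Z(g)` on the fixed-point set `Y^g`. -/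
instance fixedSubAction {G Y : Type*} [Group G] [MulAction G Y] (g : G) :
    MulAction (Subgroup.centralizer ({g} : Set G)) {y : Y // g • y = y} where
  smul h y := ⟨(h : G) • (y : Y), by
    have hc : g * (h : G) = (h : G) * g :=
      (Subgroup.mem_centralizer_iff.mp h.2) g (Set.mem_singleton g)
    calc g • ((h : G) • (y : Y)) = (g * (h : G)) • (y : Y) := (mul_smul _ _ _).symm
      _ = ((h : G) * g) • (y : Y) := by rw [hc]
      _ = (h : G) • g • (y : Y) := mul_smul _ _ _
      _ = (h : G) • (y : Y) := by rw [y.2]⟩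
  one_smul y := Subtype.ext (one_smul _ _)
  mul_smul h k y := Subtype.ext (mul_smul (h : G) (k : G) (y : Y))

/-- Permutations of `Fin m` act on maps `Fin m → X` by `g • α = α ∘ g⁻¹`. -/
instance permFunAction {m : ℕ} {X : Type*} : MulAction (Equiv.Perm (Fin m)) (Fin m → X) where
  smul g α := α ∘ ⇑g⁻¹
  one_smul α := by
    show α ∘ ⇑(1 : Equiv.Perm (Fin m))⁻¹ = α
    ext i; simp
  mul_smul g h α := by
    show α ∘ ⇑(g * h)⁻¹ = (α ∘ ⇑h⁻¹) ∘ ⇑g⁻¹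
    ext i; simp [mul_inv_rev]

/-- The partition `C(g)` of `Fin m` into the cycles (`⟨g⟩`-orbits) of a
permutation `g`, as a setoid. -/
def cyclePartition {m : ℕ} (g : Equiv.Perm (Fin m)) : Setoid (Fin m) :=
  MulAction.orbitRel (Subgroup.zpowers g) (Fin m)

/-- `b_k(π)`, the number of blocks of cardinality `k` of a partition
(setoid) `π`. -/
noncomputable def blockCount {M : Type*} (s : Setoid M) (k : ℕ) : ℕ :=
  Nat.card {B : Set M // B ∈ s.classes ∧ Nat.card B = k}

theorem card_carrier_mul_card_centralizer {G : Type*} [Group G] [Finite G] (g : G) :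
    Nat.card (ConjClasses.mk g).carrier * Nat.card (Subgroup.centralizer ({g} : Set G)) =
      Nat.card G := by
  classical
  have := Fintype.ofFinite G
  rw [Subgroup.nat_card_centralizer_nat_card_stabilizer, ← ConjAct.orbit_eq_carrier_conjClasses,
    Nat.card_eq_fintype_card, Nat.card_eq_fintype_card,
    MulAction.card_orbit_mul_card_stabilizer_eq_card_group, Nat.card_eq_fintype_card,
    ConjAct.card]

/-- Weighted Burnside lemma. -/
theorem card_nsmul_sum_orbits {H Y A : Type*} [Group H] [MulAction H Y] [Fintype H] [Fintype Y]
    [DecidableEq Y] [AddCommMonoid A] [Fintype (Quotient (MulAction.orbitRel H Y))]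
    (w : Y → A) (hw : ∀ (h : H) y, w (h • y) = w y) :
    Nat.card H • ∑ q : Quotient (MulAction.orbitRel H Y), w q.out =
      ∑ h : H, ∑ y : {y : Y // h • y = y}, w y := by
  have hw' (y : Y) : w (Quotient.out (Quotient.mk (MulAction.orbitRel H Y) y)) = w y := by
    obtain ⟨h, hh⟩ : Quotient.out (Quotient.mk (MulAction.orbitRel H Y) y) ∈ MulAction.orbit H y :=
      Quotient.mk_out (s := MulAction.orbitRel H Y) y
    rw [← hh]
    exact hw h y
  let e := MulAction.sigmaFixedByEquivOrbitsProdGroup H Y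
  have he (x) : (e x).1 = Quotient.mk (MulAction.orbitRel H Y) x.2 := rfl
  symm
  calc ∑ h : H, ∑ y : {y : Y // h • y = y}, w y
      = ∑ x : Σ h : H, {y : Y // h • y = y}, w x.2 := (Fintype.sum_sigma' _).symm
    _ = ∑ p : Quotient (MulAction.orbitRel H Y) × H, w p.1.out :=
      Fintype.sum_equiv e _ _ fun x => by rw [he, hw']
    _ = _ := by
      simp [Fintype.sum_prod_type, Finset.smul_sum, Nat.card_eq_fintype_card]

theorem blockCount_eq_card_filter {M : Type*} (s : Setoid M) [Fintype (Quotient s)] (k : ℕ) :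
    blockCount s k =
      (Finset.univ.filter fun q : Quotient s =>
        Nat.card {i // Quotient.mk s i = q} = k).card := by
  rw [← Fintype.card_subtype, ← Nat.card_eq_fintype_card, blockCount]
  refine Nat.card_congr ((Equiv.subtypeSubtypeEquivSubtypeInter _ _).symm.trans
    ((Setoid.quotientEquivClasses s).subtypeEquiv fun q => ?_).symm)
  induction q using Quotient.ind with | _ a
  rw [Setoid.quotientEquivClasses_mk_eq]
  simp only [Quotient.eq]
  rfl

/-- The total weight of the maps that are constant on the blocks of a partition. -/
theorem sum_prod_comp_mk {M X A : Type*} [CommSemiring A] [Fintype M] [Fintype X]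
    (s : Setoid M) [Fintype (Quotient s)] [DecidableEq (Quotient s)] (f : X → A) :
    ∑ β : Quotient s → X, ∏ i : M, f (β (Quotient.mk s i)) =
      ∏ k ∈ Finset.Icc 1 (Fintype.card M), (∑ x : X, f x ^ k) ^ blockCount s k := by
  calc ∑ β : Quotient s → X, ∏ i : M, f (β (Quotient.mk s i))
      = ∑ β : Quotient s → X, ∏ q : Quotient s,
          f (β q) ^ Nat.card {i // Quotient.mk s i = q} := by
        refine Finset.sum_congr rfl fun β _ => ?_
        rw [← Fintype.prod_fiberwise (Quotient.mk s)]
        refine Finset.prod_congr rfl fun q _ => ?_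
        rw [Finset.prod_congr rfl fun i _ => by rw [i.2]]
        simp
    _ = ∏ q : Quotient s, ∑ x : X, f x ^ Nat.card {i // Quotient.mk s i = q} :=
        (Fintype.prod_sum fun (q : Quotient s) x => f x ^ Nat.card {i // Quotient.mk s i = q}).symm
    _ = _ := by
        rw [← Finset.prod_fiberwise_of_maps_to
          (g := fun q : Quotient s => Nat.card {i // Quotient.mk s i = q})
          (t := Finset.Icc 1 (Fintype.card M))]
        · refine Finset.prod_congr rfl fun k _ => ?_
          rw [blockCount_eq_card_filter, Finset.prod_congr rfl fun q hq => by
            rw [(Finset.mem_filter.mp hq).2]]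
          simp
        · intro q _
          have : Nonempty {i // Quotient.mk s i = q} :=
            let ⟨i, hi⟩ := Quotient.exists_rep q; ⟨i, hi⟩
          rw [Finset.mem_Icc, ← Nat.card_eq_fintype_card (α := M)]
          exact ⟨Nat.card_pos, Finite.card_subtype_le _⟩

theorem smul_eq_self_iff_cyclePartition_le_ker {m : ℕ} {X : Type*} (g : Equiv.Perm (Fin m))
    (α : Fin m → X) : g • α = α ↔ cyclePartition g ≤ Setoid.ker α := by
  constructor
  · intro hg
    have hz : Subgroup.zpowers g ≤ MulAction.stabilizer (Equiv.Perm (Fin m)) α :=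
      (Subgroup.zpowers_le).mpr hg
    rintro _ j ⟨⟨k, hk⟩, rfl⟩
    have hkα : α ∘ ⇑k⁻¹ = α := hz hk
    have := congrFun hkα (k j)
    simpa [Setoid.ker_def, Subgroup.smul_def] using this.symm
  · intro hle
    funext i
    refine hle ⟨⟨g⁻¹, inv_mem (Subgroup.mem_zpowers g)⟩, rfl⟩

theorem sum_fixed_by_pair {m : ℕ} {X A : Type*} [Fintype X] [DecidableEq X] [CommSemiring A]
    (f : X → A) (G : Subgroup (Equiv.Perm (Fin m))) (g : G)
    (h : Subgroup.centralizer ({g} : Set G)) :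
    ∑ y : {y : {α : Fin m → X // g • α = α} // h • y = y}, ∏ i, f (y.1.1 i) =
      ∏ k ∈ Finset.Icc 1 m, (∑ x : X, f x ^ k) ^
        blockCount (cyclePartition (g : Equiv.Perm (Fin m)) ⊔
          cyclePartition ((h : G) : Equiv.Perm (Fin m))) k := by
  classical
  set s := cyclePartition (g : Equiv.Perm (Fin m)) ⊔
    cyclePartition ((h : G) : Equiv.Perm (Fin m)) with hs
  have hfix (α : Fin m → X) :
      (∃ hα : g • α = α, h • (⟨α, hα⟩ : {α : Fin m → X // g • α = α}) = ⟨α, hα⟩) ↔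
        s ≤ Setoid.ker α := by
    rw [hs, sup_le_iff, ← smul_eq_self_iff_cyclePartition_le_ker,
      ← smul_eq_self_iff_cyclePartition_le_ker]
    exact ⟨fun ⟨hα, hh⟩ => ⟨hα, congrArg Subtype.val hh⟩, fun ⟨hα, hh⟩ => ⟨hα, Subtype.ext hh⟩⟩
  let e : {y : {α : Fin m → X // g • α = α} // h • y = y} ≃ (Quotient s → X) :=
    ((Equiv.subtypeSubtypeEquivSubtypeExists _ _).trans (Equiv.subtypeEquivRight hfix)).trans
      (Setoid.liftEquiv s)
  have hM := sum_prod_comp_mk s f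
  rw [Fintype.card_fin] at hM
  rw [← hM]
  exact Fintype.sum_equiv e _ _ fun y => rfl

/-- orbi-analogue of the Pólya–Redfield theorem.
For an `A`-weighted set `(X, f)` and `G ⊆ S_m` acting on `X^[m]` with weight
`f̃(α) = Π_i f(α(i))`,
`|G| · |X^[m]/^orb G|_{f̃} = Σ_{ḡ} |ḡ| Σ_{h ∈ Z(g)} Π_{k=1}^m (|X|_{f^k})^{b_k(C(g) ∨ C(h))}`. -/
theorem orbi_polya_redfield
    {A : Type*} [CommRing A] {X : Type*} [Fintype X] (f : X → A)
    {m : ℕ} (G : Subgroup (Equiv.Perm (Fin m)))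
    (rep : ConjClasses G → G) (hrep : ∀ c, ConjClasses.mk (rep c) = c) :
    Nat.card G •
      (∑ᶠ y : (Σ c : ConjClasses G,
          Quotient (MulAction.orbitRel (Subgroup.centralizer ({rep c} : Set G))
            {α : Fin m → X // rep c • α = α})),
        ∏ i : Fin m, f ((y.2.out : Fin m → X) i)) =
    ∑ᶠ c : ConjClasses G, Nat.card (ConjClasses.carrier c) •
      ∑ᶠ h : Subgroup.centralizer ({rep c} : Set G),
        ∏ k ∈ Finset.Icc 1 m,
          (∑ x : X, f x ^ k) ^
            blockCount
              (cyclePartition ((rep c : G) : Equiv.Perm (Fin m)) ⊔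
                cyclePartition (((h : G) : Equiv.Perm (Fin m)))) k := by
  classical
  have (c : ConjClasses G) : Fintype (Quotient (MulAction.orbitRel
      (Subgroup.centralizer ({rep c} : Set G)) {α : Fin m → X // rep c • α = α})) :=
    Fintype.ofFinite _
  have := Fintype.ofFinite (ConjClasses G)
  rw [finsum_eq_sum_of_fintype, finsum_eq_sum_of_fintype, Fintype.sum_sigma, Finset.smul_sum]
  refine Finset.sum_congr rfl fun c _ => ?_
  have hcard := card_carrier_mul_card_centralizer (rep c)
  rw [hrep] at hcard
  rw [← hcard, mul_smul, finsum_eq_sum_of_fintype]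
  congr 1
  have hw (h : Subgroup.centralizer ({rep c} : Set G)) (y : {α : Fin m → X // rep c • α = α}) :
      ∏ i, f ((h • y).1 i) = ∏ i, f (y.1 i) :=
    Equiv.prod_comp (((h : G) : Equiv.Perm (Fin m))⁻¹) fun i => f (y.1 i)
  rw [card_nsmul_sum_orbits (fun y : {α : Fin m → X // rep c • α = α} => ∏ i, f (y.1 i)) hw]
  exact Finset.sum_congr rfl fun h _ => sum_fixed_by_pair f G (rep c) h
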